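/- arXiv:1001.5000 — 6 statements merged into one kernel-verified Lean document; each statement's English description precedes it below -/
import Mathlib

section
/- Let (A, μ, α) be a Hom-associative algebra and let r ∈ A⊗A. Then (A, μ, Δ = [−,r]_*, α, r) is a quasi-triangular infinitesimal Hom-bialgebra if and only if r is α-invariant and r is a solution of the associative Hom-Yang-Baxter equation A(r) = 0. -/
open TensorProduct

noncomputable section

variable {k : Type*} [Field k] {A : Type*} [AddCommGroup A] [Module k A]

/-- `(A, μ, α)` is a Hom-associative algebra: multiplicativity and Hom-associativity. -/
def IsHomAssociative (μ : A ⊗[k] A →ₗ[k] A) (α : A →ₗ[k] A) : Prop :=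
  (∀ x y : A, α (μ (x ⊗ₜ y)) = μ (α x ⊗ₜ α y)) ∧
  (∀ x y z : A, μ (α x ⊗ₜ μ (y ⊗ₜ z)) = μ (μ (x ⊗ₜ y) ⊗ₜ α z))

/-- `(A, Δ, α)` is a Hom-coassociative coalgebra: comultiplicativity and
Hom-coassociativity (the latter via the associator). -/
def IsHomCoassociative (Δ : A →ₗ[k] A ⊗[k] A) (α : A →ₗ[k] A) : Prop :=
  (∀ a : A, Δ (α a) = TensorProduct.map α α (Δ a)) ∧
  (∀ a : A, TensorProduct.map α Δ (Δ a)
      = TensorProduct.assoc k A A A (TensorProduct.map Δ α (Δ a)))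

/-- The cocycle condition `Δ∘μ = (μ⊗α)∘(α⊗Δ) + (α⊗μ)∘(Δ⊗α)`. -/
def IsCocycle (μ : A ⊗[k] A →ₗ[k] A) (Δ : A →ₗ[k] A ⊗[k] A) (α : A →ₗ[k] A) : Prop :=
  ∀ a b : A,
    Δ (μ (a ⊗ₜ b)) =
      TensorProduct.map μ α ((TensorProduct.assoc k A A A).symm (α a ⊗ₜ Δ b)) +
      TensorProduct.map α μ (TensorProduct.assoc k A A A (Δ a ⊗ₜ α b))

/-- Infinitesimal Hom-bialgebra. -/
def IsInfHomBialgebra (μ : A ⊗[k] A →ₗ[k] A) (Δ : A →ₗ[k] A ⊗[k] A)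
    (α : A →ₗ[k] A) : Prop :=
  IsHomAssociative μ α ∧ IsHomCoassociative Δ α ∧ IsCocycle μ Δ α

/-- `[a, -]_*` : sends `Σ b₁⊗b₂` to `Σ μ(a,b₁)⊗α(b₂) − α(b₁)⊗μ(b₂,a)`. -/
def starBracket (μ : A ⊗[k] A →ₗ[k] A) (α : A →ₗ[k] A) (a : A) :
    A ⊗[k] A →ₗ[k] A ⊗[k] A :=
  TensorProduct.map (μ ∘ₗ TensorProduct.mk k A A a) α
    - TensorProduct.map α (μ ∘ₗ (TensorProduct.mk k A A).flip a)

/-- Coboundary infinitesimal Hom-bialgebra: an infinitesimal Hom-bialgebra with an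
`α`-invariant `r` such that `Δ = [-, r]_*`. -/
def IsCoboundary (μ : A ⊗[k] A →ₗ[k] A) (Δ : A →ₗ[k] A ⊗[k] A) (α : A →ₗ[k] A)
    (r : A ⊗[k] A) : Prop :=
  IsInfHomBialgebra μ Δ α ∧ TensorProduct.map α α r = r ∧
    ∀ a : A, Δ a = starBracket μ α a r

/-- `[a, -]_•` on 2-tensors: `Σ μ(α(a),b₁)⊗α(b₂) − α(b₁)⊗μ(b₂,α(a))`. -/
def dotBracket2 (μ : A ⊗[k] A →ₗ[k] A) (α : A →ₗ[k] A) (a : A) :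
    A ⊗[k] A →ₗ[k] A ⊗[k] A :=
  TensorProduct.map (μ ∘ₗ TensorProduct.mk k A A (α a)) α
    - TensorProduct.map α (μ ∘ₗ (TensorProduct.mk k A A).flip (α a))

/-- `[a, -]_•` on 3-tensors: `Σ μ(α(a),b₁)⊗α(b₂)⊗α(b₃) − α(b₁)⊗α(b₂)⊗μ(b₃,α(a))`. -/
def dotBracket3 (μ : A ⊗[k] A →ₗ[k] A) (α : A →ₗ[k] A) (a : A) :
    A ⊗[k] (A ⊗[k] A) →ₗ[k] A ⊗[k] (A ⊗[k] A) :=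
  TensorProduct.map (μ ∘ₗ TensorProduct.mk k A A (α a)) (TensorProduct.map α α)
    - TensorProduct.map α
        (TensorProduct.map α (μ ∘ₗ (TensorProduct.mk k A A).flip (α a)))

/-- `(r, s) ↦ r₁₃s₁₂ = Σ μ(uᵢ,uⱼ')⊗α(vⱼ')⊗α(vᵢ)` for `r = Σ uᵢ⊗vᵢ`, `s = Σ uⱼ'⊗vⱼ'`. -/
def t13_12 (μ : A ⊗[k] A →ₗ[k] A) (α : A →ₗ[k] A) :
    (A ⊗[k] A) ⊗[k] (A ⊗[k] A) →ₗ[k] A ⊗[k] (A ⊗[k] A) :=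
  TensorProduct.map μ
      (TensorProduct.map α α ∘ₗ (TensorProduct.comm k A A).toLinearMap)
    ∘ₗ (TensorProduct.tensorTensorTensorComm k A A A A).toLinearMap

/-- `(r, s) ↦ r₁₂s₂₃ = Σ α(uᵢ)⊗μ(vᵢ,uⱼ')⊗α(vⱼ')`. -/
def t12_23 (μ : A ⊗[k] A →ₗ[k] A) (α : A →ₗ[k] A) :
    (A ⊗[k] A) ⊗[k] (A ⊗[k] A) →ₗ[k] A ⊗[k] (A ⊗[k] A) :=
  TensorProduct.map α
      (TensorProduct.map μ α ∘ₗ (TensorProduct.assoc k A A A).symm.toLinearMap)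
    ∘ₗ (TensorProduct.assoc k A A (A ⊗[k] A)).toLinearMap

/-- `(r, s) ↦ r₂₃s₁₃ = Σ α(uⱼ')⊗α(uᵢ)⊗μ(vᵢ,vⱼ')`. -/
def t23_13 (μ : A ⊗[k] A →ₗ[k] A) (α : A →ₗ[k] A) :
    (A ⊗[k] A) ⊗[k] (A ⊗[k] A) →ₗ[k] A ⊗[k] (A ⊗[k] A) :=
  (TensorProduct.assoc k A A A).toLinearMap
    ∘ₗ TensorProduct.map
        (TensorProduct.map α α ∘ₗ (TensorProduct.comm k A A).toLinearMap) μ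
    ∘ₗ (TensorProduct.tensorTensorTensorComm k A A A A).toLinearMap

/-- `A(r) = r₁₃r₁₂ − r₁₂r₂₃ + r₂₃r₁₃`. -/
def Atensor (μ : A ⊗[k] A →ₗ[k] A) (α : A →ₗ[k] A) (r : A ⊗[k] A) :
    A ⊗[k] (A ⊗[k] A) :=
  t13_12 μ α (r ⊗ₜ r) - t12_23 μ α (r ⊗ₜ r) + t23_13 μ α (r ⊗ₜ r)

/-- Quasi-triangular infinitesimal Hom-bialgebra: coboundary with `A(r) = 0`. -/
def IsQuasiTriangular (μ : A ⊗[k] A →ₗ[k] A) (Δ : A →ₗ[k] A ⊗[k] A) (α : A →ₗ[k] A)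
    (r : A ⊗[k] A) : Prop :=
  IsCoboundary μ Δ α r ∧ Atensor μ α r = 0

/-- The balanceator `B(x,y) = [x, Δᵒᵖ(y)]_• + τ([y, Δᵒᵖ(x)]_•)`. -/
def balanceator (μ : A ⊗[k] A →ₗ[k] A) (Δ : A →ₗ[k] A ⊗[k] A) (α : A →ₗ[k] A)
    (x y : A) : A ⊗[k] A :=
  dotBracket2 μ α x (TensorProduct.comm k A A (Δ y))
    + TensorProduct.comm k A A (dotBracket2 μ α y (TensorProduct.comm k A A (Δ x)))

/-- `ad_x` on 2-tensors, for a bilinear bracket `br`: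
`y₁⊗y₂ ↦ [x,y₁]⊗α(y₂) + α(y₁)⊗[x,y₂]`. -/
def adMap (br : A →ₗ[k] A →ₗ[k] A) (α : A →ₗ[k] A) (x : A) :
    A ⊗[k] A →ₗ[k] A ⊗[k] A :=
  TensorProduct.map (br x) α + TensorProduct.map α (br x)

/-- Cyclic rotation on triple tensors: `x⊗y⊗z ↦ y⊗z⊗x`. -/
def cyc3 : A ⊗[k] (A ⊗[k] A) →ₗ[k] A ⊗[k] (A ⊗[k] A) :=
  (TensorProduct.assoc k A A A).toLinearMap
    ∘ₗ (TensorProduct.comm k A (A ⊗[k] A)).toLinearMap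

/-- Hom-Lie bialgebra: Hom-Lie algebra, Hom-Lie coalgebra, and the cocycle
compatibility `δ([x,y]) = ad_{α(x)}(δ(y)) − ad_{α(y)}(δ(x))`. -/
def IsHomLieBialgebra (br : A →ₗ[k] A →ₗ[k] A) (δ : A →ₗ[k] A ⊗[k] A)
    (α : A →ₗ[k] A) : Prop :=
  (∀ x y : A, br x y = - br y x) ∧
  (∀ x y : A, α (br x y) = br (α x) (α y)) ∧
  (∀ x y z : A, br (br x y) (α z) + br (br z x) (α y) + br (br y z) (α x) = 0) ∧
  (∀ x : A, δ (α x) = TensorProduct.map α α (δ x)) ∧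
  (∀ x : A, TensorProduct.comm k A A (δ x) = - δ x) ∧
  (∀ x : A, TensorProduct.map α δ (δ x) + cyc3 (TensorProduct.map α δ (δ x))
      + cyc3 (cyc3 (TensorProduct.map α δ (δ x))) = 0) ∧
  (∀ x y : A, δ (br x y) = adMap br α (α x) (δ y) - adMap br α (α y) (δ x))

/-- The commutator bracket of `μ`, as a bilinear map. -/
def commBracket (μ : A ⊗[k] A →ₗ[k] A) : A →ₗ[k] A →ₗ[k] A :=
  TensorProduct.curry μ - (TensorProduct.curry μ).flip

/-- The cocommutator cobracket `(Id − τ)∘Δ`. -/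
def cobracket (Δ : A →ₗ[k] A ⊗[k] A) : A →ₗ[k] A ⊗[k] A :=
  Δ - (TensorProduct.comm k A A).toLinearMap ∘ₗ Δ

/-- `(r, s) ↦ [r₁₂, s₁₃] = Σ β(uᵢ⊗uⱼ')⊗α(vᵢ)⊗α(vⱼ')` for a bracket `β`. -/
def c12_13 (β : A ⊗[k] A →ₗ[k] A) (α : A →ₗ[k] A) :
    (A ⊗[k] A) ⊗[k] (A ⊗[k] A) →ₗ[k] A ⊗[k] (A ⊗[k] A) :=
  TensorProduct.map β (TensorProduct.map α α)
    ∘ₗ (TensorProduct.tensorTensorTensorComm k A A A A).toLinearMap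

/-- `(r, s) ↦ [r₁₂, s₂₃] = Σ α(uᵢ)⊗β(vᵢ⊗uⱼ')⊗α(vⱼ')`. -/
def c12_23 (β : A ⊗[k] A →ₗ[k] A) (α : A →ₗ[k] A) :
    (A ⊗[k] A) ⊗[k] (A ⊗[k] A) →ₗ[k] A ⊗[k] (A ⊗[k] A) :=
  TensorProduct.map α
      (TensorProduct.map β α ∘ₗ (TensorProduct.assoc k A A A).symm.toLinearMap)
    ∘ₗ (TensorProduct.assoc k A A (A ⊗[k] A)).toLinearMap

/-- `(r, s) ↦ [r₁₃, s₂₃] = Σ α(uᵢ)⊗α(uⱼ')⊗β(vᵢ⊗vⱼ')`. -/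
def c13_23 (β : A ⊗[k] A →ₗ[k] A) (α : A →ₗ[k] A) :
    (A ⊗[k] A) ⊗[k] (A ⊗[k] A) →ₗ[k] A ⊗[k] (A ⊗[k] A) :=
  (TensorProduct.assoc k A A A).toLinearMap
    ∘ₗ TensorProduct.map (TensorProduct.map α α) β
    ∘ₗ (TensorProduct.tensorTensorTensorComm k A A A A).toLinearMap

/-- `C(r) = [r₁₂,r₁₃] + [r₁₂,r₂₃] + [r₁₃,r₂₃]` for a bracket `β`. -/
def Ctensor (β : A ⊗[k] A →ₗ[k] A) (α : A →ₗ[k] A) (r : A ⊗[k] A) :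
    A ⊗[k] (A ⊗[k] A) :=
  c12_13 β α (r ⊗ₜ r) + c12_23 β α (r ⊗ₜ r) + c13_23 β α (r ⊗ₜ r)

/-- The bracket `[a, t]_*` as a linear map in `t` and `a`. -/
def starBracketLin (μ : A ⊗[k] A →ₗ[k] A) (α : A →ₗ[k] A) :
    A ⊗[k] A →ₗ[k] A →ₗ[k] A ⊗[k] A :=
  LinearMap.mk₂ k (fun t a => starBracket μ α a t)
    (fun s t a => map_add _ s t)
    (fun c t a => map_smul _ c t)
    (fun t a b => by
      simp only [starBracket, map_add, LinearMap.comp_add, TensorProduct.map_add_left,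
        TensorProduct.map_add_right, LinearMap.add_apply, LinearMap.sub_apply]
      abel)
    (fun c t a => by
      simp only [starBracket, map_smul, LinearMap.comp_smul, TensorProduct.map_smul_left,
        TensorProduct.map_smul_right, LinearMap.smul_apply, LinearMap.sub_apply, smul_sub])

@[simp]
theorem starBracketLin_apply (μ : A ⊗[k] A →ₗ[k] A) (α : A →ₗ[k] A) (t : A ⊗[k] A) (a : A) :
    starBracketLin μ α t a = starBracket μ α a t := rfl

theorem starBracket_tmul (μ : A ⊗[k] A →ₗ[k] A) (α : A →ₗ[k] A) (a u v : A) :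
    starBracket μ α a (u ⊗ₜ v) = μ (a ⊗ₜ u) ⊗ₜ α v - α u ⊗ₜ μ (v ⊗ₜ a) := by
  simp [starBracket]

theorem starBracket_map (μ : A ⊗[k] A →ₗ[k] A) (α : A →ₗ[k] A) (hA : IsHomAssociative μ α)
    (a : A) (t : A ⊗[k] A) :
    starBracket μ α (α a) (TensorProduct.map α α t)
      = TensorProduct.map α α (starBracket μ α a t) := by
  induction t with
  | zero => simp
  | add s t hs ht => simp only [map_add, hs, ht]
  | tmul u v => simp [starBracket_tmul, hA.1]

theorem starBracket_mul (μ : A ⊗[k] A →ₗ[k] A) (α : A →ₗ[k] A) (hA : IsHomAssociative μ α)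
    (a b : A) (t : A ⊗[k] A) :
    starBracket μ α (μ (a ⊗ₜ b)) (TensorProduct.map α α t) =
      TensorProduct.map μ α ((TensorProduct.assoc k A A A).symm (α a ⊗ₜ starBracket μ α b t)) +
      TensorProduct.map α μ
        (TensorProduct.assoc k A A A (starBracket μ α a t ⊗ₜ α b)) := by
  induction t with
  | zero => simp
  | add s t hs ht =>
    simp only [map_add, hs, ht, tmul_add, add_tmul]
    abel
  | tmul u v => simp [starBracket_tmul, hA.1, hA.2, tmul_sub, sub_tmul]

/-- `Σ μ(α(a), b₁) ⊗ α(b₂) ⊗ α(b₃)`, the left half of `[a, -]_•` on 3-tensors. -/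
def leftAct3 (μ : A ⊗[k] A →ₗ[k] A) (α : A →ₗ[k] A) (a : A) :
    A ⊗[k] (A ⊗[k] A) →ₗ[k] A ⊗[k] (A ⊗[k] A) :=
  TensorProduct.map (μ ∘ₗ TensorProduct.mk k A A (α a)) (TensorProduct.map α α)

/-- `Σ α(b₁) ⊗ α(b₂) ⊗ μ(b₃, α(a))`, the right half of `[a, -]_•` on 3-tensors. -/
def rightAct3 (μ : A ⊗[k] A →ₗ[k] A) (α : A →ₗ[k] A) (a : A) :
    A ⊗[k] (A ⊗[k] A) →ₗ[k] A ⊗[k] (A ⊗[k] A) :=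
  TensorProduct.map α (TensorProduct.map α (μ ∘ₗ (TensorProduct.mk k A A).flip (α a)))

/-- `(s, t) ↦ Σ α²(u) ⊗ (v·a)·α(u') ⊗ α²(v')` for `s = Σ u ⊗ v`, `t = Σ u' ⊗ v'`. -/
def middleAct (μ : A ⊗[k] A →ₗ[k] A) (α : A →ₗ[k] A) (a : A) :
    (A ⊗[k] A) ⊗[k] (A ⊗[k] A) →ₗ[k] A ⊗[k] (A ⊗[k] A) :=
  t12_23 μ α ∘ₗ TensorProduct.map
    (TensorProduct.map α (μ ∘ₗ (TensorProduct.mk k A A).flip a)) (TensorProduct.map α α)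

theorem map_starBracketLin_right (μ : A ⊗[k] A →ₗ[k] A) (α : A →ₗ[k] A)
    (hA : IsHomAssociative μ α) (a : A) (s t : A ⊗[k] A) :
    TensorProduct.map α (starBracketLin μ α (TensorProduct.map α α t)) (starBracket μ α a s)
      = leftAct3 μ α a (t12_23 μ α (s ⊗ₜ t)) - leftAct3 μ α a (t23_13 μ α (t ⊗ₜ s))
        - middleAct μ α a (s ⊗ₜ t) + rightAct3 μ α a (t23_13 μ α (t ⊗ₜ s)) := by
  induction t with
  | zero => simp
  | add t t' h h' =>
    simp only [map_add, TensorProduct.map_add_right, LinearMap.add_apply, tmul_add, add_tmul,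
      h, h']
    abel
  | tmul u' v' =>
    induction s with
    | zero => simp
    | add s s' h h' =>
      simp only [map_add, tmul_add, add_tmul, h, h']
      abel
    | tmul u v =>
      simp [starBracket_tmul, leftAct3, rightAct3, middleAct, t12_23, t23_13, hA.1, hA.2,
        tmul_sub]
      abel

theorem map_starBracketLin_left (μ : A ⊗[k] A →ₗ[k] A) (α : A →ₗ[k] A)
    (hA : IsHomAssociative μ α) (a : A) (s t : A ⊗[k] A) :
    TensorProduct.assoc k A A A
        (TensorProduct.map (starBracketLin μ α (TensorProduct.map α α t)) α
          (starBracket μ α a s))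
      = leftAct3 μ α a (t13_12 μ α (s ⊗ₜ t)) - middleAct μ α a (t ⊗ₜ s)
        - rightAct3 μ α a (t13_12 μ α (s ⊗ₜ t)) + rightAct3 μ α a (t12_23 μ α (t ⊗ₜ s)) := by
  induction t with
  | zero => simp
  | add t t' h h' =>
    simp only [map_add, TensorProduct.map_add_left, LinearMap.add_apply, tmul_add, add_tmul,
      h, h']
    abel
  | tmul u' v' =>
    induction s with
    | zero => simp
    | add s s' h h' =>
      simp only [map_add, tmul_add, add_tmul, h, h']
      abel
    | tmul u v =>
      simp [starBracket_tmul, leftAct3, rightAct3, middleAct, t12_23, t13_12, hA.1, hA.2,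
        sub_tmul]
      abel

/-- The failure of Hom-coassociativity of `[-, r]_*` is `-[a, A(r)]_•`. -/
theorem starBracketLin_coassoc (μ : A ⊗[k] A →ₗ[k] A) (α : A →ₗ[k] A)
    (hA : IsHomAssociative μ α) (r : A ⊗[k] A) (hr : TensorProduct.map α α r = r) (a : A) :
    TensorProduct.map α (starBracketLin μ α r) (starBracket μ α a r)
      - TensorProduct.assoc k A A A
          (TensorProduct.map (starBracketLin μ α r) α (starBracket μ α a r))
      = -dotBracket3 μ α a (Atensor μ α r) := by
  have hR := map_starBracketLin_right μ α hA a r r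
  have hL := map_starBracketLin_left μ α hA a r r
  rw [hr] at hR hL
  rw [hR, hL, show dotBracket3 μ α a = leftAct3 μ α a - rightAct3 μ α a from rfl]
  simp only [Atensor, LinearMap.sub_apply, map_add, map_sub]
  abel

/-- `(A, μ, Δ = [−,r]_*, α, r)` is quasi-triangular iff `r` is
`α`-invariant and solves the AHYBE. -/
theorem stmt13 [CharZero k]
    (μ : A ⊗[k] A →ₗ[k] A) (α : A →ₗ[k] A) (r : A ⊗[k] A)
    (hA : IsHomAssociative μ α)
    (Δ : A →ₗ[k] A ⊗[k] A) (hΔ : ∀ a : A, Δ a = starBracket μ α a r) :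
    IsQuasiTriangular μ Δ α r ↔
      (TensorProduct.map α α r = r ∧ Atensor μ α r = 0) := by
  refine ⟨fun h => ⟨h.1.2.1, h.2⟩, fun ⟨hr, hY⟩ =>
    ⟨⟨⟨hA, ⟨fun a => ?_, fun a => ?_⟩, fun a b => ?_⟩, hr, hΔ⟩, hY⟩⟩
  · rw [hΔ, hΔ, ← starBracket_map μ α hA, hr]
  · obtain rfl : Δ = starBracketLin μ α r := LinearMap.ext hΔ
    rw [← sub_eq_zero, starBracketLin_apply, starBracketLin_coassoc μ α hA r hr, hY, map_zero,
      neg_zero]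
  · simpa only [hΔ, hr] using starBracket_mul μ α hA a b r
end
end

section
/- Let (A, μ, Δ, α, r) be a coboundary infinitesimal Hom-bialgebra. Then the following three statements are equivalent: (1) A(r) = 0; (2) (α⊗Δ)(r) = r₁₃r₁₂; (3) (Δ⊗α)(r) = −r₂₃r₁₃. -/
open TensorProduct

noncomputable section

variable {k : Type*} [Field k] {A : Type*} [AddCommGroup A] [Module k A]

/-- `(α⊗[-, s]_*)(r) = r₁₂s₂₃ − s₂₃r₁₃`. -/
theorem map_alpha_comul_eq (μ : A ⊗[k] A →ₗ[k] A) (Δ : A →ₗ[k] A ⊗[k] A)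
    (α : A →ₗ[k] A) (s : A ⊗[k] A) (hΔ : ∀ a : A, Δ a = starBracket μ α a s)
    (r : A ⊗[k] A) :
    TensorProduct.map α Δ r = t12_23 μ α (r ⊗ₜ s) - t23_13 μ α (s ⊗ₜ r) := by
  induction r using TensorProduct.induction_on with
  | zero => simp
  | add x y hx hy =>
    rw [map_add, hx, hy, add_tmul, tmul_add, map_add, map_add]
    abel
  | tmul u v =>
    rw [map_tmul, hΔ]
    clear hΔ
    induction s using TensorProduct.induction_on with
    | zero => simp
    | add x y hx hy =>
      rw [map_add, tmul_add, hx, hy, add_tmul, tmul_add, map_add, map_add]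
      abel
    | tmul a b => simp [starBracket, t12_23, t23_13, tmul_sub]

/-- `([-, s]_*⊗α)(r) = r₁₃s₁₂ − s₁₂r₂₃`. -/
theorem assoc_map_comul_alpha_eq (μ : A ⊗[k] A →ₗ[k] A) (Δ : A →ₗ[k] A ⊗[k] A)
    (α : A →ₗ[k] A) (s : A ⊗[k] A) (hΔ : ∀ a : A, Δ a = starBracket μ α a s)
    (r : A ⊗[k] A) :
    TensorProduct.assoc k A A A (TensorProduct.map Δ α r)
      = t13_12 μ α (r ⊗ₜ s) - t12_23 μ α (s ⊗ₜ r) := by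
  induction r using TensorProduct.induction_on with
  | zero => simp
  | add x y hx hy =>
    rw [map_add, map_add, hx, hy, add_tmul, tmul_add, map_add, map_add]
    abel
  | tmul u v =>
    rw [map_tmul, hΔ]
    clear hΔ
    induction s using TensorProduct.induction_on with
    | zero => simp
    | add x y hx hy =>
      rw [map_add, add_tmul, map_add, hx, hy, add_tmul, tmul_add, map_add, map_add]
      abel
    | tmul a b => simp [starBracket, t12_23, t13_12, sub_tmul]

/-- in a coboundary infinitesimal Hom-bialgebra,
`A(r) = 0 ↔ (α⊗Δ)(r) = r₁₃r₁₂ ↔ (Δ⊗α)(r) = −r₂₃r₁₃`. -/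
theorem stmt14 [CharZero k]
    (μ : A ⊗[k] A →ₗ[k] A) (Δ : A →ₗ[k] A ⊗[k] A) (α : A →ₗ[k] A) (r : A ⊗[k] A)
    (h : IsCoboundary μ Δ α r) :
    (Atensor μ α r = 0 ↔ TensorProduct.map α Δ r = t13_12 μ α (r ⊗ₜ r)) ∧
    (Atensor μ α r = 0 ↔
      TensorProduct.assoc k A A A (TensorProduct.map Δ α r)
        = - t23_13 μ α (r ⊗ₜ r)) := by
  obtain ⟨-, -, hΔ⟩ := h
  rw [map_alpha_comul_eq μ Δ α r hΔ, assoc_map_comul_alpha_eq μ Δ α r hΔ, Atensor]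
  refine ⟨?_, add_eq_zero_iff_eq_neg⟩
  rw [sub_add, sub_eq_zero, eq_comm]

end
end

section
/- Let (A, μ, Δ, α) be an infinitesimal Hom-bialgebra. Define the commutator bracket [x,y] = μ(x,y) − μ(y,x) and the cocommutator cobracket δ = (Id − τ)∘Δ, where τ is the twist map on A⊗A. Then for all x, y ∈ A: δ([x,y]) = ad_{α(x)}(δ(y)) − ad_{α(y)}(δ(x)) + B(x,y) − B(y,x), where ad_z(y₁⊗y₂) = [z,y₁]⊗α(y₂) + α(y₁)⊗[z,y₂] and B is the balanceator of A. -/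
open TensorProduct

noncomputable section

variable {k : Type*} [Field k] {A : Type*} [AddCommGroup A] [Module k A]

/-- The part of the compatibility between cobracket and bracket that is linear in a single
2-tensor `t`, with `α x` acting on it by left and right multiplication. -/
theorem sub_comm_act_eq_adMap_add_dotBracket2 (μ : A ⊗[k] A →ₗ[k] A) (α : A →ₗ[k] A) (x : A)
    (t : A ⊗[k] A) :
    TensorProduct.map μ α ((TensorProduct.assoc k A A A).symm (α x ⊗ₜ t))
      - TensorProduct.comm k A A
          (TensorProduct.map μ α ((TensorProduct.assoc k A A A).symm (α x ⊗ₜ t)))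
      - TensorProduct.map α μ (TensorProduct.assoc k A A A (t ⊗ₜ α x))
      + TensorProduct.comm k A A
          (TensorProduct.map α μ (TensorProduct.assoc k A A A (t ⊗ₜ α x))) =
    adMap (commBracket μ) α (α x) (t - TensorProduct.comm k A A t)
      + dotBracket2 μ α x (TensorProduct.comm k A A t)
      - TensorProduct.comm k A A (dotBracket2 μ α x (TensorProduct.comm k A A t)) := by
  induction t with
  | zero => simp
  | tmul u v =>
    simp only [adMap, commBracket, dotBracket2, TensorProduct.assoc_symm_tmul,
      TensorProduct.assoc_tmul, TensorProduct.map_tmul, TensorProduct.comm_tmul,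
      LinearMap.add_apply, LinearMap.sub_apply, LinearMap.comp_apply, LinearMap.flip_apply,
      TensorProduct.mk_apply, TensorProduct.curry_apply, map_sub, TensorProduct.sub_tmul,
      TensorProduct.tmul_sub]
    abel
  | add s t hs ht =>
    simp only [TensorProduct.tmul_add, TensorProduct.add_tmul, map_add, map_sub] at hs ht ⊢
    linear_combination (norm := module) hs + ht

/-- in an infinitesimal Hom-bialgebra, with commutator bracket and
cocommutator cobracket,
`δ([x,y]) = ad_{α(x)}(δ(y)) − ad_{α(y)}(δ(x)) + B(x,y) − B(y,x)`. -/
theorem stmt15 [CharZero k]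
    (μ : A ⊗[k] A →ₗ[k] A) (Δ : A →ₗ[k] A ⊗[k] A) (α : A →ₗ[k] A)
    (h : IsInfHomBialgebra μ Δ α) :
    ∀ x y : A,
      cobracket Δ (μ (x ⊗ₜ y) - μ (y ⊗ₜ x)) =
        adMap (commBracket μ) α (α x) (cobracket Δ y)
          - adMap (commBracket μ) α (α y) (cobracket Δ x)
          + balanceator μ Δ α x y - balanceator μ Δ α y x := by
  intro x y
  have hx := sub_comm_act_eq_adMap_add_dotBracket2 μ α x (Δ y)
  have hy := sub_comm_act_eq_adMap_add_dotBracket2 μ α y (Δ x)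
  simp only [cobracket, balanceator, LinearMap.sub_apply, LinearMap.comp_apply,
    LinearEquiv.coe_coe, map_sub, map_add, h.2.2 x y, h.2.2 y x] at hx hy ⊢
  linear_combination (norm := module) hx - hy

end
end

section
/- Let (A, μ, Δ, α) be an infinitesimal Hom-bialgebra with balanceator B, and set [x,y] = μ(x,y) − μ(y,x) and δ = (Id − τ)∘Δ. Then A_{HLie} = (A, [−,−], δ, α) is a Hom-Lie bialgebra if and only if B is symmetric, i.e., B(x,y) = B(y,x) for all x, y ∈ A. -/
open TensorProduct

noncomputable section

variable {k : Type*} [Field k] {A : Type*} [AddCommGroup A] [Module k A]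

theorem cyc3_cyc3_cyc3 (t : A ⊗[k] (A ⊗[k] A)) : cyc3 (cyc3 (cyc3 t)) = t := by
  induction t with
  | zero => simp
  | add t u ht hu => simp only [map_add, ht, hu]
  | tmul x t =>
    induction t with
    | zero => simp
    | add t u ht hu => simp only [TensorProduct.tmul_add, map_add, ht, hu]
    | tmul y z => simp [cyc3]

theorem lTensor_comm_cyc3_cyc3 (t : A ⊗[k] (A ⊗[k] A)) :
    (TensorProduct.comm k A A).toLinearMap.lTensor A (cyc3 (cyc3 t)) =
      cyc3 ((TensorProduct.comm k A A).toLinearMap.lTensor A t) := by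
  induction t with
  | zero => simp
  | add t u ht hu => simp only [map_add, ht, hu]
  | tmul x t =>
    induction t with
    | zero => simp
    | add t u ht hu => simp only [TensorProduct.tmul_add, map_add, ht, hu]
    | tmul y z => simp [cyc3]

theorem cyc3_assoc_tmul (t : A ⊗[k] A) (z : A) :
    cyc3 (cyc3 (TensorProduct.assoc k A A A (t ⊗ₜ z))) = z ⊗ₜ t := by
  induction t with
  | zero => simp
  | add t u ht hu => simp only [TensorProduct.add_tmul, TensorProduct.tmul_add, map_add, ht, hu]
  | tmul x y => simp [cyc3]

theorem map_comm_eq_cyc3 (Δ : A →ₗ[k] A ⊗[k] A) (α : A →ₗ[k] A) (u : A ⊗[k] A) :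
    TensorProduct.map α Δ (TensorProduct.comm k A A u) =
      cyc3 (cyc3 (TensorProduct.assoc k A A A (TensorProduct.map Δ α u))) := by
  induction u with
  | zero => simp
  | add t u ht hu => simp only [map_add, ht, hu]
  | tmul x y => simp [cyc3_assoc_tmul]

theorem map_cobracket (Δ : A →ₗ[k] A ⊗[k] A) (α : A →ₗ[k] A) (u : A ⊗[k] A) :
    TensorProduct.map α (cobracket Δ) u = TensorProduct.map α Δ u -
      (TensorProduct.comm k A A).toLinearMap.lTensor A (TensorProduct.map α Δ u) := by
  induction u with
  | zero => simp
  | add t u ht hu => simp only [map_add, ht, hu]; abel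
  | tmul x y => simp [cobracket, TensorProduct.tmul_sub]

/-- Hom-co-Jacobi identity for the cocommutator of a Hom-coassociative coalgebra. -/
theorem cobracket_coJacobi {Δ : A →ₗ[k] A ⊗[k] A} {α : A →ₗ[k] A}
    (h : IsHomCoassociative Δ α) (x : A) :
    TensorProduct.map α (cobracket Δ) (cobracket Δ x)
      + cyc3 (TensorProduct.map α (cobracket Δ) (cobracket Δ x))
      + cyc3 (cyc3 (TensorProduct.map α (cobracket Δ) (cobracket Δ x))) = 0 := by
  have hc : cobracket Δ x = Δ x - TensorProduct.comm k A A (Δ x) := rfl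
  have ht : TensorProduct.map α Δ (TensorProduct.comm k A A (Δ x)) =
      cyc3 (cyc3 (TensorProduct.map α Δ (Δ x))) := by
    rw [map_comm_eq_cyc3, ← h.2]
  rw [hc, map_cobracket, map_sub, ht]
  simp only [map_sub, lTensor_comm_cyc3_cyc3, cyc3_cyc3_cyc3]
  abel

/-- Hom-Jacobi identity for the commutator of a Hom-associative algebra. -/
theorem commBracket_jacobi {μ : A ⊗[k] A →ₗ[k] A} {α : A →ₗ[k] A}
    (h : IsHomAssociative μ α) (x y z : A) :
    commBracket μ (commBracket μ x y) (α z) + commBracket μ (commBracket μ z x) (α y)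
      + commBracket μ (commBracket μ y z) (α x) = 0 := by
  simp only [commBracket, LinearMap.sub_apply, LinearMap.flip_apply, TensorProduct.curry_apply,
    map_sub, h.2]
  abel

theorem cobracket_comp {Δ : A →ₗ[k] A ⊗[k] A} {α : A →ₗ[k] A}
    (h : ∀ a : A, Δ (α a) = TensorProduct.map α α (Δ a)) (x : A) :
    cobracket Δ (α x) = TensorProduct.map α α (cobracket Δ x) := by
  simp only [cobracket, LinearMap.sub_apply, LinearMap.comp_apply, LinearEquiv.coe_coe, map_sub, h,
    TensorProduct.map_comm]

/-- The part of `ad_{α(x)}(δ(y)) - δ([x,y])` depending on `Δ(y) = u`. -/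
theorem adMap_sub_comm (μ : A ⊗[k] A →ₗ[k] A) (α : A →ₗ[k] A) (x : A) (u : A ⊗[k] A) :
    adMap (commBracket μ) α (α x) (u - TensorProduct.comm k A A u)
      - (dotBracket2 μ α x u - TensorProduct.comm k A A (dotBracket2 μ α x u)) =
    TensorProduct.comm k A A (dotBracket2 μ α x (TensorProduct.comm k A A u))
      - dotBracket2 μ α x (TensorProduct.comm k A A u) := by
  induction u with
  | zero => simp
  | add t u ht hu =>
    simp only [map_add, map_sub] at ht hu ⊢
    linear_combination (norm := module) ht + hu
  | tmul a b =>
    simp only [adMap, dotBracket2, commBracket, map_sub, TensorProduct.comm_tmul,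
      LinearMap.add_apply, LinearMap.sub_apply, TensorProduct.map_tmul, LinearMap.flip_apply,
      TensorProduct.curry_apply, LinearMap.comp_apply, TensorProduct.mk_apply,
      TensorProduct.tmul_sub, TensorProduct.sub_tmul]
    abel

theorem map_mul_assoc_sub (μ : A ⊗[k] A →ₗ[k] A) (α : A →ₗ[k] A) (x : A) (u : A ⊗[k] A) :
    TensorProduct.map μ α ((TensorProduct.assoc k A A A).symm (α x ⊗ₜ u))
      - TensorProduct.map α μ (TensorProduct.assoc k A A A (u ⊗ₜ α x)) = dotBracket2 μ α x u := by
  induction u with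
  | zero => simp
  | add t u ht hu =>
    simp only [map_add, TensorProduct.tmul_add, TensorProduct.add_tmul, ← ht, ← hu]
    abel
  | tmul a b => simp [dotBracket2]

theorem comul_commBracket {μ : A ⊗[k] A →ₗ[k] A} {Δ : A →ₗ[k] A ⊗[k] A} {α : A →ₗ[k] A}
    (h : IsCocycle μ Δ α) (x y : A) :
    Δ (commBracket μ x y) = dotBracket2 μ α x (Δ y) - dotBracket2 μ α y (Δ x) := by
  simp only [commBracket, LinearMap.sub_apply, LinearMap.flip_apply, TensorProduct.curry_apply,
    map_sub, h x y, h y x, ← map_mul_assoc_sub]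
  abel

/-- The failure of the Lie cocycle condition is the antisymmetrization of the balanceator. -/
theorem adMap_cobracket_sub {μ : A ⊗[k] A →ₗ[k] A} {Δ : A →ₗ[k] A ⊗[k] A} {α : A →ₗ[k] A}
    (h : IsCocycle μ Δ α) (x y : A) :
    adMap (commBracket μ) α (α x) (cobracket Δ y) - adMap (commBracket μ) α (α y) (cobracket Δ x)
      - cobracket Δ (commBracket μ x y) = balanceator μ Δ α y x - balanceator μ Δ α x y := by
  have hc (a : A) : cobracket Δ a = Δ a - TensorProduct.comm k A A (Δ a) := rfl
  have hx := adMap_sub_comm μ α x (Δ y)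
  have hy := adMap_sub_comm μ α y (Δ x)
  simp only [hc, comul_commBracket h, balanceator]
  rw [map_sub (TensorProduct.comm k A A)]
  linear_combination (norm := module) hx - hy

/-- `A_{HLie}` is a Hom-Lie bialgebra iff the balanceator is
symmetric. -/
theorem stmt16 [CharZero k]
    (μ : A ⊗[k] A →ₗ[k] A) (Δ : A →ₗ[k] A ⊗[k] A) (α : A →ₗ[k] A)
    (h : IsInfHomBialgebra μ Δ α) :
    IsHomLieBialgebra (commBracket μ) (cobracket Δ) α ↔
      ∀ x y : A, balanceator μ Δ α x y = balanceator μ Δ α y x := by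
  obtain ⟨hA, hC, hcoc⟩ := h
  constructor
  · rintro ⟨-, -, -, -, -, -, hL⟩ x y
    have hxy := adMap_cobracket_sub hcoc x y
    rw [← hL x y, sub_self] at hxy
    exact (sub_eq_zero.mp hxy.symm).symm
  · intro hB
    refine ⟨fun x y => ?_, fun x y => ?_, commBracket_jacobi hA, cobracket_comp hC.1,
      fun x => ?_, cobracket_coJacobi hC, fun x y => ?_⟩
    · simp [commBracket]
    · simp [commBracket, hA.1]
    · simp [cobracket]
    · have hxy := adMap_cobracket_sub hcoc x y
      rw [hB y x, sub_self] at hxy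
      exact (sub_eq_zero.mp hxy).symm

end
end

section
/- Let (A, μ, Δ) be an infinitesimal bialgebra with balanceator B (computed with α = Id) and let α : A → A be a morphism of infinitesimal bialgebras. Then the balanceator B_α of the infinitesimal Hom-bialgebra A_α = (A, α∘μ, Δ∘α, α) satisfies B_α = (α²⊗α²)∘B. Consequently, if B is symmetric then so is B_α, and if B_α is symmetric and α⊗α is injective then B is symmetric. -/
open TensorProduct

noncomputable section

variable {k : Type*} [Field k] {A : Type*} [AddCommGroup A] [Module k A]

/-- Twisting by an algebra morphism `α` turns the bullet bracket into its image under
`α² ⊗ α²`. -/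
theorem dotBracket2_twist (μ : A ⊗[k] A →ₗ[k] A) (α : A →ₗ[k] A)
    (hαμ : ∀ x y : A, α (μ (x ⊗ₜ y)) = μ (α x ⊗ₜ α y)) (x : A) (t : A ⊗[k] A) :
    dotBracket2 (α ∘ₗ μ) α x (TensorProduct.map α α t)
      = TensorProduct.map (α ∘ₗ α) (α ∘ₗ α) (dotBracket2 μ LinearMap.id x t) := by
  induction t with
  | zero => simp
  | tmul a b => simp [dotBracket2, hαμ]
  | add s t hs ht => simp only [map_add, hs, ht]

/-- The balanceator of the twist by a morphism `α` is `α² ⊗ α²` applied to the original one. -/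
theorem balanceator_twist (μ : A ⊗[k] A →ₗ[k] A) (Δ : A →ₗ[k] A ⊗[k] A) (α : A →ₗ[k] A)
    (hαμ : ∀ x y : A, α (μ (x ⊗ₜ y)) = μ (α x ⊗ₜ α y))
    (hαΔ : ∀ a : A, Δ (α a) = TensorProduct.map α α (Δ a)) (x y : A) :
    balanceator (α ∘ₗ μ) (Δ ∘ₗ α) α x y
      = TensorProduct.map (α ∘ₗ α) (α ∘ₗ α) (balanceator μ Δ LinearMap.id x y) := by
  simp only [balanceator, LinearMap.comp_apply, hαΔ, ← TensorProduct.map_comm,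
    dotBracket2_twist μ α hαμ, map_add]

/-- the balanceator of the twisted infinitesimal Hom-bialgebra `A_α`
satisfies `B_α = (α²⊗α²)∘B`; in particular symmetry of `B` transfers to `B_α`, and
conversely if `α⊗α` is injective. -/
theorem stmt17 [CharZero k]
    (μ : A ⊗[k] A →ₗ[k] A) (Δ : A →ₗ[k] A ⊗[k] A)
    (h : IsInfHomBialgebra μ Δ (LinearMap.id : A →ₗ[k] A))
    (α : A →ₗ[k] A)
    (hαμ : ∀ x y : A, α (μ (x ⊗ₜ y)) = μ (α x ⊗ₜ α y))
    (hαΔ : ∀ a : A, Δ (α a) = TensorProduct.map α α (Δ a)) :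
    (∀ x y : A, balanceator (α ∘ₗ μ) (Δ ∘ₗ α) α x y
        = TensorProduct.map (α ∘ₗ α) (α ∘ₗ α)
            (balanceator μ Δ (LinearMap.id : A →ₗ[k] A) x y)) ∧
    ((∀ x y : A, balanceator μ Δ (LinearMap.id : A →ₗ[k] A) x y
          = balanceator μ Δ (LinearMap.id : A →ₗ[k] A) y x) →
      ∀ x y : A, balanceator (α ∘ₗ μ) (Δ ∘ₗ α) α x y
          = balanceator (α ∘ₗ μ) (Δ ∘ₗ α) α y x) ∧
    ((∀ x y : A, balanceator (α ∘ₗ μ) (Δ ∘ₗ α) α x y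
          = balanceator (α ∘ₗ μ) (Δ ∘ₗ α) α y x) →
      Function.Injective (TensorProduct.map α α) →
      ∀ x y : A, balanceator μ Δ (LinearMap.id : A →ₗ[k] A) x y
          = balanceator μ Δ (LinearMap.id : A →ₗ[k] A) y x) := by
  have key := balanceator_twist μ Δ α hαμ hαΔ
  refine ⟨key, fun hB x y => by rw [key, key, hB], fun hB hinj x y => ?_⟩
  have hxy := hB x y
  simp only [key, TensorProduct.map_comp, LinearMap.comp_apply] at hxy
  exact hinj (hinj hxy)

end
end

section
/- Let (A, μ, α) be a Hom-associative algebra and let r ∈ A⊗A be a solution of the associative Hom-Yang-Baxter equation A(r) = 0. Suppose r is either symmetric (τ(r) = r) or anti-symmetric (τ(r) = −r). Then r is a solution of the classical Hom-Yang-Baxter equation C(r) = 0 in the commutator Hom-Lie algebra A_{HLie} = (A, [−,−], α), where [x,y] = μ(x,y) − μ(y,x). -/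
open TensorProduct

noncomputable section

variable {k : Type*} [Field k] {A : Type*} [AddCommGroup A] [Module k A]

/-- Reversal of triple tensors: `x⊗y⊗z ↦ z⊗y⊗x`. -/
def rev3 : A ⊗[k] (A ⊗[k] A) →ₗ[k] A ⊗[k] (A ⊗[k] A) :=
  (TensorProduct.assoc k A A A).toLinearMap
    ∘ₗ TensorProduct.map (TensorProduct.comm k A A).toLinearMap LinearMap.id
    ∘ₗ (TensorProduct.comm k A (A ⊗[k] A)).toLinearMap

theorem c12_13_commutator (μ : A ⊗[k] A →ₗ[k] A) (α : A →ₗ[k] A) (r s : A ⊗[k] A) :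
    c12_13 (μ - μ ∘ₗ (TensorProduct.comm k A A).toLinearMap) α (r ⊗ₜ s) =
      rev3 (t23_13 μ α (TensorProduct.comm k A A r ⊗ₜ TensorProduct.comm k A A s))
        - t13_12 μ α (s ⊗ₜ r) := by
  induction r with
  | zero => simp
  | add r₁ r₂ h₁ h₂ => simp only [add_tmul, tmul_add, map_add, h₁, h₂]; abel
  | tmul u v =>
    induction s with
    | zero => simp
    | add s₁ s₂ h₁ h₂ => simp only [add_tmul, tmul_add, map_add, h₁, h₂]; abel
    | tmul u' v' => simp [c12_13, t23_13, t13_12, rev3, sub_tmul]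

theorem c12_23_commutator (μ : A ⊗[k] A →ₗ[k] A) (α : A →ₗ[k] A) (r s : A ⊗[k] A) :
    c12_23 (μ - μ ∘ₗ (TensorProduct.comm k A A).toLinearMap) α (r ⊗ₜ s) =
      t12_23 μ α (r ⊗ₜ s)
        - rev3 (t12_23 μ α (TensorProduct.comm k A A s ⊗ₜ TensorProduct.comm k A A r)) := by
  induction r with
  | zero => simp
  | add r₁ r₂ h₁ h₂ => simp only [add_tmul, tmul_add, map_add, h₁, h₂]; abel
  | tmul u v =>
    induction s with
    | zero => simp
    | add s₁ s₂ h₁ h₂ => simp only [add_tmul, tmul_add, map_add, h₁, h₂]; abel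
    | tmul u' v' => simp [c12_23, t12_23, rev3, sub_tmul, tmul_sub]

theorem c13_23_commutator (μ : A ⊗[k] A →ₗ[k] A) (α : A →ₗ[k] A) (r s : A ⊗[k] A) :
    c13_23 (μ - μ ∘ₗ (TensorProduct.comm k A A).toLinearMap) α (r ⊗ₜ s) =
      rev3 (t13_12 μ α (TensorProduct.comm k A A r ⊗ₜ TensorProduct.comm k A A s))
        - t23_13 μ α (s ⊗ₜ r) := by
  induction r with
  | zero => simp
  | add r₁ r₂ h₁ h₂ => simp only [add_tmul, tmul_add, map_add, h₁, h₂]; abel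
  | tmul u v =>
    induction s with
    | zero => simp
    | add s₁ s₂ h₁ h₂ => simp only [add_tmul, tmul_add, map_add, h₁, h₂]; abel
    | tmul u' v' => simp [c13_23, t23_13, t13_12, rev3, tmul_sub]

theorem Ctensor_commutator (μ : A ⊗[k] A →ₗ[k] A) (α : A →ₗ[k] A) (r : A ⊗[k] A) :
    Ctensor (μ - μ ∘ₗ (TensorProduct.comm k A A).toLinearMap) α r =
      rev3 (Atensor μ α (TensorProduct.comm k A A r)) - Atensor μ α r := by
  simp only [Ctensor, Atensor, c12_13_commutator, c12_23_commutator, c13_23_commutator,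
    map_add, map_sub]
  abel

theorem Atensor_neg (μ : A ⊗[k] A →ₗ[k] A) (α : A →ₗ[k] A) (r : A ⊗[k] A) :
    Atensor μ α (-r) = Atensor μ α r := by
  simp [Atensor, neg_tmul, tmul_neg]

/-- a symmetric or anti-symmetric solution of the AHYBE is a solution
of the CHYBE in the commutator Hom-Lie algebra. -/
theorem stmt19 [CharZero k]
    (μ : A ⊗[k] A →ₗ[k] A) (α : A →ₗ[k] A) (r : A ⊗[k] A)
    (hA : IsHomAssociative μ α)
    (hr : Atensor μ α r = 0)
    (hsym : TensorProduct.comm k A A r = r ∨ TensorProduct.comm k A A r = - r) :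
    Ctensor (μ - μ ∘ₗ (TensorProduct.comm k A A).toLinearMap) α r = 0 := by
  rw [Ctensor_commutator]
  rcases hsym with h | h <;> simp [h, Atensor_neg, hr]

end
end
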